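/- arXiv:2004.10482 — 6 statements merged into one kernel-verified Lean document; each statement's English description precedes it below -/
import Mathlib

section
/- The category Pred(Σ₀) of decidable primitive recursive predicates has finite limits: it has a terminal object, binary products, and equalizers. -/
open CategoryTheory

/-- Objects of the category `Pred(Σ₀)`: decidable primitive recursive predicates on `ℕ`,
i.e. primitive recursive functions `ℕ → Bool`. -/
structure PredSigma : Type where
  /-- The underlying decidable predicate. -/
  pred : ℕ → Bool
  /-- It is primitive recursive. -/
  prim : Primrec pred

namespace PredSigma

/-- Representatives of morphisms `p ⟶ q` in `Pred(Σ₀)`: primitive recursive functions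
`f : ℕ → ℕ` mapping the extension of `p` into the extension of `q`. -/
def HomRep (p q : PredSigma) : Type :=
  { f : ℕ → ℕ // Nat.Primrec f ∧ ∀ n, p.pred n = true → q.pred (f n) = true }

/-- Two representatives are identified when they agree on the extension of `p`. -/
instance homSetoid (p q : PredSigma) : Setoid (HomRep p q) where
  r f g := ∀ n, p.pred n = true → f.1 n = g.1 n
  iseqv := ⟨fun _ _ _ => rfl, fun h n hn => (h n hn).symm,
    fun h h' n hn => (h n hn).trans (h' n hn)⟩

/-- The category `Pred(Σ₀)` of decidable primitive recursive predicates. -/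
instance : Category PredSigma where
  Hom p q := Quotient (homSetoid p q)
  id p := ⟦⟨id, Nat.Primrec.id, fun _ h => h⟩⟧
  comp {p q r} F G :=
    Quotient.liftOn₂ F G
      (fun f g => (⟦⟨fun n => g.1 (f.1 n), g.2.1.comp f.2.1,
        fun n hn => g.2.2 _ (f.2.2 n hn)⟩⟧ : Quotient (homSetoid p r)))
      (fun f g f' g' hf hg => Quotient.sound fun n hn => by
        show g.1 (f.1 n) = g'.1 (f'.1 n)
        rw [hf n hn, hg _ (f'.2.2 n hn)])
  id_comp {p q} F := Quotient.inductionOn F fun f => Quotient.sound fun n _ => rfl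
  comp_id {p q} F := Quotient.inductionOn F fun f => Quotient.sound fun n _ => rfl
  assoc {p q r s} F G H := Quotient.inductionOn₃ F G H
    (fun f g h => Quotient.sound fun n _ => rfl)

end PredSigma

open CategoryTheory.Limits

namespace PredSigma

/-- The morphism represented by a primitive recursive function. -/
def homMk {p q : PredSigma} (f : ℕ → ℕ) (hf : Nat.Primrec f)
    (h : ∀ n, p.pred n = true → q.pred (f n) = true) : p ⟶ q :=
  Quotient.mk (homSetoid p q) ⟨f, hf, h⟩

theorem exists_eq_homMk {p q : PredSigma} (F : p ⟶ q) : ∃ f hf h, F = homMk f hf h :=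
  Quotient.inductionOn F fun f => ⟨f.1, f.2.1, f.2.2, rfl⟩

theorem homMk_eq_iff {p q : PredSigma} {f g : ℕ → ℕ} {hf hg hfp hgp} :
    (homMk f hf hfp : p ⟶ q) = homMk g hg hgp ↔ ∀ n, p.pred n = true → f n = g n :=
  ⟨fun h => Quotient.exact h, fun h => Quotient.sound h⟩

theorem homMk_comp {p q r : PredSigma} {f g : ℕ → ℕ} {hf hg hfp hgp} :
    (homMk f hf hfp : p ⟶ q) ≫ (homMk g hg hgp : q ⟶ r) =
      homMk (fun n => g (f n)) (hg.comp hf) (fun n hn => hgp _ (hfp n hn)) :=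
  rfl

/-- The predicate satisfied by `0` only. -/
def terminal : PredSigma where
  pred n := decide (n = 0)
  prim := PrimrecPred.decide (Primrec.eq.comp Primrec.id (Primrec.const 0))

theorem hasTerminal : HasTerminal PredSigma := by
  refine (IsTerminal.ofUniqueHom (Y := terminal)
    (fun _ => homMk (fun _ => 0) .zero fun _ _ => rfl) fun p F => ?_).hasTerminal
  obtain ⟨f, hf, h, rfl⟩ := exists_eq_homMk F
  exact homMk_eq_iff.2 fun n hn => of_decide_eq_true (h n hn)

/-- The conjunction of `p` and `q` on the two components of a pair. -/
def prod (p q : PredSigma) : PredSigma where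
  pred n := p.pred n.unpair.1 && q.pred n.unpair.2
  prim := Primrec.and.comp (p.prim.comp (Primrec.fst.comp Primrec.unpair))
    (q.prim.comp (Primrec.snd.comp Primrec.unpair))

/-- The first projection. -/
def prodFst (p q : PredSigma) : prod p q ⟶ p :=
  homMk _ .left fun _ hn => (Bool.and_eq_true_iff.1 hn).1

/-- The second projection. -/
def prodSnd (p q : PredSigma) : prod p q ⟶ q :=
  homMk _ .right fun _ hn => (Bool.and_eq_true_iff.1 hn).2

theorem exists_prod_lift {p q r : PredSigma} (F : r ⟶ p) (G : r ⟶ q) :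
    ∃ H : r ⟶ prod p q, H ≫ prodFst p q = F ∧ H ≫ prodSnd p q = G := by
  obtain ⟨f, hf, hfp, rfl⟩ := exists_eq_homMk F
  obtain ⟨g, hg, hgq, rfl⟩ := exists_eq_homMk G
  refine ⟨homMk (fun n => Nat.pair (f n) (g n)) (hf.pair hg) fun n hn => ?_, ?_, ?_⟩
  · simp [prod, hfp n hn, hgq n hn]
  · simp [prodFst, homMk_comp]
  · simp [prodSnd, homMk_comp]

theorem prod_hom_ext {p q r : PredSigma} {F G : r ⟶ prod p q}
    (h₁ : F ≫ prodFst p q = G ≫ prodFst p q) (h₂ : F ≫ prodSnd p q = G ≫ prodSnd p q) :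
    F = G := by
  obtain ⟨f, hf, hfp, rfl⟩ := exists_eq_homMk F
  obtain ⟨g, hg, hgp, rfl⟩ := exists_eq_homMk G
  simp only [prodFst, prodSnd, homMk_comp, homMk_eq_iff] at h₁ h₂ ⊢
  intro n hn
  rw [← Nat.pair_unpair (f n), h₁ n hn, h₂ n hn, Nat.pair_unpair]

theorem hasBinaryProducts : HasBinaryProducts PredSigma := by
  have (p q : PredSigma) : HasLimit (pair p q) := by
    choose lift lift_fst lift_snd using @exists_prod_lift p q
    exact ⟨⟨⟨BinaryFan.mk (prodFst p q) (prodSnd p q),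
      BinaryFan.IsLimit.mk _ (fun F G => lift F G) (fun F G => lift_fst F G)
        (fun F G => lift_snd F G)
        fun F G m h₁ h₂ => prod_hom_ext (h₁.trans (lift_fst F G).symm)
          (h₂.trans (lift_snd F G).symm)⟩⟩⟩
  exact hasBinaryProducts_of_hasLimit_pair _

/-- The part of `p` on which the primitive recursive functions `f` and `g` agree. -/
def eqLocus (p : PredSigma) {f g : ℕ → ℕ} (hf : Nat.Primrec f) (hg : Nat.Primrec g) :
    PredSigma where
  pred n := p.pred n && decide (f n = g n)
  prim := Primrec.and.comp p.prim
    (PrimrecPred.decide (Primrec.eq.comp (Primrec.nat_iff.2 hf) (Primrec.nat_iff.2 hg)))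

/-- The inclusion of `eqLocus` into `p`. -/
def eqLocusι (p : PredSigma) {f g : ℕ → ℕ} (hf : Nat.Primrec f) (hg : Nat.Primrec g) :
    eqLocus p hf hg ⟶ p :=
  homMk id .id fun _ hn => (Bool.and_eq_true_iff.1 hn).1

theorem eqLocusι_hom_ext {p r : PredSigma} {f g : ℕ → ℕ} (hf : Nat.Primrec f)
    (hg : Nat.Primrec g) {F G : r ⟶ eqLocus p hf hg}
    (h : F ≫ eqLocusι p hf hg = G ≫ eqLocusι p hf hg) : F = G := by
  obtain ⟨k, hk, hkp, rfl⟩ := exists_eq_homMk F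
  obtain ⟨l, hl, hlp, rfl⟩ := exists_eq_homMk G
  simpa only [eqLocusι, homMk_comp, homMk_eq_iff, id] using h

theorem hasEqualizers : HasEqualizers PredSigma := by
  have {p q : PredSigma} {F G : p ⟶ q} : HasLimit (parallelPair F G) := by
    obtain ⟨f, hf, hfq, rfl⟩ := exists_eq_homMk F
    obtain ⟨g, hg, hgq, rfl⟩ := exists_eq_homMk G
    have w : eqLocusι p hf hg ≫ homMk f hf hfq = eqLocusι p hf hg ≫ homMk g hg hgq := by
      rw [eqLocusι, homMk_comp, homMk_comp, homMk_eq_iff]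
      exact fun n hn => of_decide_eq_true (Bool.and_eq_true_iff.1 hn).2
    refine ⟨⟨⟨Fork.ofι (eqLocusι p hf hg) w, Fork.IsLimit.ofExistsUnique fun s => ?_⟩⟩⟩
    obtain ⟨k, hk, hkp, e⟩ := exists_eq_homMk s.ι
    have hfg := s.condition
    rw [e, homMk_comp, homMk_comp, homMk_eq_iff] at hfg
    exact ⟨homMk k hk fun n hn => Bool.and_eq_true_iff.2
      ⟨hkp n hn, decide_eq_true (hfg n hn)⟩, e.symm, fun m hm => eqLocusι_hom_ext hf hg (hm.trans e)⟩
  exact hasEqualizers_of_hasLimit_parallelPair _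

end PredSigma

/-- The category `Pred(Σ₀)` of decidable primitive recursive predicates has finite
limits: a terminal object, binary products and equalizers. -/
theorem predSigma_hasFiniteLimits :
    HasTerminal PredSigma ∧ HasBinaryProducts PredSigma ∧ HasEqualizers PredSigma :=
  ⟨PredSigma.hasTerminal, PredSigma.hasBinaryProducts, PredSigma.hasEqualizers⟩
end

section
/- In the category Pred(Σ₀) of decidable primitive recursive predicates, every morphism factors as a split epimorphism followed by a monomorphism. In particular Pred(Σ₀) is a regular category satisfying the axiom of choice. -/
open CategoryTheory

/-- The least `k < n` satisfying `p` with `f k = f n`, or `n` if there is none. -/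
def leastPreimage (p : ℕ → Bool) (f : ℕ → ℕ) (n : ℕ) : ℕ :=
  (List.range n).findIdx fun k => p k && f k == f n

section leastPreimage

variable {p : ℕ → Bool} {f : ℕ → ℕ} {m n : ℕ}

theorem primrec_leastPreimage (hp : Primrec p) (hf : Primrec f) :
    Primrec (leastPreimage p f) :=
  Primrec.list_findIdx Primrec.list_range <|
    Primrec.and.comp₂ (hp.comp₂ Primrec₂.right) <|
      Primrec.beq.comp₂ (hf.comp₂ Primrec₂.right) (hf.comp₂ Primrec₂.left)

theorem leastPreimage_spec (hn : p n = true) :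
    p (leastPreimage p f n) = true ∧ f (leastPreimage p f n) = f n := by
  have hle : leastPreimage p f n ≤ n := by
    simpa [leastPreimage] using List.findIdx_le_length (p := fun k => p k && f k == f n) (xs := List.range n)
  rcases hle.lt_or_eq with h | h
  · have := List.findIdx_getElem (p := fun k => p k && f k == f n) (xs := List.range n)
      (w := by simpa [leastPreimage] using h)
    simpa using! this
  · rw [h]
    exact ⟨hn, rfl⟩

theorem leastPreimage_le (hm : p m = true) (h : f m = f n) : leastPreimage p f n ≤ m := by
  by_contra! hlt
  have := List.not_of_lt_findIdx (p := fun k => p k && f k == f n) (xs := List.range n) hlt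
  simp [hm, h] at this

theorem leastPreimage_congr (hm : p m = true) (hn : p n = true) (h : f m = f n) :
    leastPreimage p f m = leastPreimage p f n := by
  obtain ⟨hm₁, hm₂⟩ := leastPreimage_spec (f := f) hm
  obtain ⟨hn₁, hn₂⟩ := leastPreimage_spec (f := f) hn
  exact le_antisymm (leastPreimage_le hn₁ (hn₂.trans h.symm)) (leastPreimage_le hm₁ (hm₂.trans h))

end leastPreimage

namespace PredSigma

/-- The image of `f` on the extension of `p`, represented by the least preimages of its values. -/
def image (p : PredSigma) (f : ℕ → ℕ) (hf : Nat.Primrec f) : PredSigma where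
  pred n := p.pred n && leastPreimage p.pred f n == n
  prim := Primrec.and.comp p.prim <|
    Primrec.beq.comp (primrec_leastPreimage p.prim (Primrec.nat_iff.2 hf)) Primrec.id

theorem image_pred_iff {p : PredSigma} {f : ℕ → ℕ} {hf : Nat.Primrec f} {n : ℕ} :
    (image p f hf).pred n = true ↔ p.pred n = true ∧ leastPreimage p.pred f n = n := by
  simp [image]

theorem mono_mk {p q : PredSigma} (f : HomRep p q)
    (hf : ∀ m n, p.pred m = true → p.pred n = true → f.1 m = f.1 n → m = n) :
    Mono (show p ⟶ q from ⟦f⟧) where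
  right_cancellation g h := Quotient.inductionOn₂ g h fun g h hgh =>
    Quotient.sound fun n hn =>
      hf _ _ (g.2.2 n hn) (h.2.2 n hn) (Quotient.exact hgh n hn)

end PredSigma


/-- In the category `Pred(Σ₀)` of decidable primitive recursive predicates, every
morphism factors as a split epimorphism followed by a monomorphism (the image being
carved out by primitive recursive bounded minimization). -/
theorem predSigma_splitEpi_mono_factorization {p q : PredSigma} (f : p ⟶ q) :
    ∃ (m : PredSigma) (e : p ⟶ m) (i : m ⟶ q),
      IsSplitEpi e ∧ Mono i ∧ e ≫ i = f := by
  induction f using Quotient.inductionOn with | _ f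
  obtain ⟨f, hf, hpq⟩ := f
  have image_pred {n : ℕ} := PredSigma.image_pred_iff (p := p) (hf := hf) (n := n)
  refine ⟨PredSigma.image p f hf,
    ⟦⟨leastPreimage p.pred f,
      Primrec.nat_iff.1 (primrec_leastPreimage p.prim (Primrec.nat_iff.2 hf)), fun n hn => ?_⟩⟧,
    ⟦⟨f, hf, fun n hn => hpq n (image_pred.1 hn).1⟩⟧,
    ⟨⟨⟨⟦⟨id, Nat.Primrec.id, fun n hn => (image_pred.1 hn).1⟩⟧, ?_⟩⟩⟩, ?_, ?_⟩
  · obtain ⟨h₁, h₂⟩ := leastPreimage_spec (f := f) hn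
    exact image_pred.2 ⟨h₁, leastPreimage_congr h₁ hn h₂⟩
  · exact Quotient.sound fun n hn => (image_pred.1 hn).2
  · refine PredSigma.mono_mk _ fun m n hm hn h => ?_
    obtain ⟨hm₁, hm₂⟩ := image_pred.1 hm
    obtain ⟨hn₁, hn₂⟩ := image_pred.1 hn
    rw [← hm₂, ← hn₂]
    exact leastPreimage_congr hm₁ hn₁ h
  · exact Quotient.sound fun n hn => (leastPreimage_spec hn).2
end

section
/- The category Pred(Σ₀) of decidable primitive recursive predicates has finite coproducts: it has an initial object and binary coproducts. -/
open CategoryTheory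

open CategoryTheory.Limits

namespace PredSigma

/-- The class of a representative, as a morphism of `Pred(Σ₀)`. -/
def ofRep {p q : PredSigma} (f : HomRep p q) : p ⟶ q :=
  Quotient.mk (homSetoid p q) f

theorem exists_ofRep {p q : PredSigma} (F : p ⟶ q) : ∃ f : HomRep p q, ofRep f = F :=
  Quotient.exists_rep F

theorem ofRep_eq_iff {p q : PredSigma} {f g : HomRep p q} :
    ofRep f = ofRep g ↔ ∀ n, p.pred n = true → f.1 n = g.1 n :=
  ⟨fun h => Quotient.exact h, fun h => Quotient.sound h⟩

/-- Composition of representatives. -/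
def HomRep.comp {p q r : PredSigma} (f : HomRep p q) (g : HomRep q r) : HomRep p r :=
  ⟨fun n => g.1 (f.1 n), g.2.1.comp f.2.1, fun n hn => g.2.2 _ (f.2.2 n hn)⟩

theorem ofRep_comp {p q r : PredSigma} (f : HomRep p q) (g : HomRep q r) :
    ofRep f ≫ ofRep g = ofRep (f.comp g) :=
  rfl

/-- The constantly-false predicate. -/
def empty : PredSigma :=
  ⟨fun _ => false, Primrec.const false⟩

/-- The constantly-false predicate is initial. -/
def emptyIsInitial : IsInitial empty :=
  IsInitial.ofUniqueHom (fun _ => ofRep ⟨id, Nat.Primrec.id, fun _ h => nomatch h⟩)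
    fun p F => by
      obtain ⟨f, rfl⟩ := exists_ofRep F
      exact ofRep_eq_iff.2 fun _ h => nomatch h

/-- Definition by cases on the tag `n.unpair.2` is primitive recursive. -/
theorem primrec_tag_ite {α : Type*} [Primcodable α] (k : ℕ) {f : ℕ → α} {g : ℕ → α}
    (hf : Primrec f) (hg : Primrec g) :
    Primrec fun n : ℕ => if n.unpair.2 = k then f n.unpair.1 else g n :=
  Primrec.ite (Primrec.eq.comp (Primrec.snd.comp Primrec.unpair) (Primrec.const k))
    (hf.comp (Primrec.fst.comp Primrec.unpair)) hg

/-- The disjoint union of `p × {0}` and `q × {1}`, coded via `Nat.pair`. -/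
def coprod (p q : PredSigma) : PredSigma where
  pred n :=
    if n.unpair.2 = 0 then p.pred n.unpair.1
    else if n.unpair.2 = 1 then q.pred n.unpair.1 else false
  prim := primrec_tag_ite 0 p.prim (primrec_tag_ite 1 q.prim (Primrec.const false))

/-- Pairing with a fixed tag is primitive recursive. -/
theorem primrec_pair_const (k : ℕ) : Nat.Primrec fun n => Nat.pair n k :=
  Nat.Primrec.id.pair (Nat.Primrec.const k)

/-- The left inclusion into the coproduct. -/
def inlRep (p q : PredSigma) : HomRep p (coprod p q) :=
  ⟨fun n => Nat.pair n 0, primrec_pair_const 0, fun n hn => by simpa [coprod] using hn⟩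

/-- The right inclusion into the coproduct. -/
def inrRep (p q : PredSigma) : HomRep q (coprod p q) :=
  ⟨fun n => Nat.pair n 1, primrec_pair_const 1, fun n hn => by simpa [coprod] using hn⟩

theorem coprod_cases {p q : PredSigma} {n : ℕ} (h : (coprod p q).pred n = true) :
    (∃ a, p.pred a = true ∧ n = Nat.pair a 0) ∨ ∃ a, q.pred a = true ∧ n = Nat.pair a 1 := by
  have hn := Nat.pair_unpair n
  simp only [coprod] at h
  split_ifs at h with h₀ h₁
  · exact Or.inl ⟨_, h, by rw [← h₀, hn]⟩
  · exact Or.inr ⟨_, h, by rw [← h₁, hn]⟩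

/-- The copairing of two representatives. -/
def descRep {p q r : PredSigma} (f : HomRep p r) (g : HomRep q r) : HomRep (coprod p q) r :=
  ⟨fun n => if n.unpair.2 = 0 then f.1 n.unpair.1 else g.1 n.unpair.1,
    Primrec.nat_iff.1 (primrec_tag_ite 0 (Primrec.nat_iff.2 f.2.1)
      ((Primrec.nat_iff.2 g.2.1).comp (Primrec.fst.comp Primrec.unpair))),
    fun n hn => by
      obtain ⟨a, ha, rfl⟩ | ⟨a, ha, rfl⟩ := coprod_cases hn
      · simpa using f.2.2 a ha
      · simpa using g.2.2 a ha⟩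

/-- Morphisms out of the coproduct are determined by their restrictions to the summands. -/
theorem coprod_hom_ext {p q r : PredSigma} {F G : coprod p q ⟶ r}
    (hl : ofRep (inlRep p q) ≫ F = ofRep (inlRep p q) ≫ G)
    (hr : ofRep (inrRep p q) ≫ F = ofRep (inrRep p q) ≫ G) : F = G := by
  obtain ⟨f, rfl⟩ := exists_ofRep F
  obtain ⟨g, rfl⟩ := exists_ofRep G
  rw [ofRep_comp, ofRep_comp, ofRep_eq_iff] at hl hr
  refine ofRep_eq_iff.2 fun n hn => ?_
  obtain ⟨a, ha, rfl⟩ | ⟨a, ha, rfl⟩ := coprod_cases hn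
  · exact hl a ha
  · exact hr a ha

theorem exists_coprod_desc {p q r : PredSigma} (F : p ⟶ r) (G : q ⟶ r) :
    ∃ H : coprod p q ⟶ r, ofRep (inlRep p q) ≫ H = F ∧ ofRep (inrRep p q) ≫ H = G := by
  obtain ⟨f, rfl⟩ := exists_ofRep F
  obtain ⟨g, rfl⟩ := exists_ofRep G
  refine ⟨ofRep (descRep f g), ?_, ?_⟩ <;>
    exact ofRep_eq_iff.2 fun n _ => by simp [inlRep, inrRep, descRep]

/-- The coded disjoint union is a coproduct. -/
noncomputable def coprodIsColimit (p q : PredSigma) :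
    IsColimit (BinaryCofan.mk (ofRep (inlRep p q)) (ofRep (inrRep p q))) :=
  BinaryCofan.IsColimit.mk _ (fun F G => (exists_coprod_desc F G).choose)
    (fun F G => (exists_coprod_desc F G).choose_spec.1)
    (fun F G => (exists_coprod_desc F G).choose_spec.2)
    fun F G _ hl hr => coprod_hom_ext
      (hl.trans (exists_coprod_desc F G).choose_spec.1.symm)
      (hr.trans (exists_coprod_desc F G).choose_spec.2.symm)

end PredSigma

/-- The category `Pred(Σ₀)` of decidable primitive recursive predicates has finite
coproducts: an initial object (the constantly-false predicate) and binary coproducts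
(disjoint unions coded via `Nat.pair`). -/
theorem predSigma_hasFiniteCoproducts :
    HasInitial PredSigma ∧ HasBinaryCoproducts PredSigma := by
  have (p q : PredSigma) : HasColimit (pair p q) :=
    ⟨⟨⟨_, PredSigma.coprodIsColimit p q⟩⟩⟩
  exact ⟨PredSigma.emptyIsInitial.hasInitial, hasBinaryCoproducts_of_hasColimit_pair _⟩
end

section
/- (Löb's Theorem, algebraic form.) Let H be a Heyting algebra and □ : H → H an operator satisfying the derivability conditions: (A1) if x = ⊤ then □x = ⊤; (A2) □x ≤ □□x for all x; (A3) □(x ⇨ y) ≤ (□x ⇨ □y) for all x, y. Let φ ∈ H and suppose there exists a Löb sentence L ∈ H with L = (□L ⇨ φ) (diagonalization). If □φ ≤ φ, then φ = ⊤. -/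
/-- **Löb's theorem, algebraic form.** Let `H` be a Heyting algebra and `□ : H → H` an
operator satisfying the derivability conditions (A1) necessitation, (A2) `□x ≤ □□x`,
(A3) internal modus ponens `□(x ⇨ y) ≤ □x ⇨ □y`.  If the Löb sentence
`L = (□L ⇨ φ)` exists (diagonalization) and `□φ ≤ φ`, then `φ = ⊤`. -/
theorem loeb_theorem {H : Type*} [HeytingAlgebra H] (box : H → H)
    (A1 : ∀ x : H, x = ⊤ → box x = ⊤)
    (A2 : ∀ x : H, box x ≤ box (box x))
    (A3 : ∀ x y : H, box (x ⇨ y) ≤ box x ⇨ box y)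
    (φ : H) (L : H) (hL : L = (box L ⇨ φ))
    (hφ : box φ ≤ φ) : φ = ⊤ := by
  have h : box L ≤ box (box L) ⇨ box φ := (congrArg box hL).le.trans (A3 _ _)
  have hbox : box L ≤ φ := (le_inf le_rfl (A2 L)).trans ((le_himp_iff.mp h).trans hφ)
  have hL_top : L = ⊤ := hL.trans (himp_eq_top_iff.mpr hbox)
  exact top_le_iff.mp ((A1 L hL_top).ge.trans hbox)
end

section
/- (Gödel's Second Incompleteness Theorem, algebraic form.) Let H be a Heyting algebra and □ : H → H an operator satisfying: (A1) if x = ⊤ then □x = ⊤; (A2) □x ≤ □□x for all x; (A3) □(x ⇨ y) ≤ (□x ⇨ □y) for all x, y. Suppose there exists L ∈ H with L = (□L ⇨ ⊥). If H is nondegenerate, i.e. ⊥ ≠ ⊤, then □⊥ ≠ ⊥; that is, the consistency statement '□⊥ = ⊥' is not provable. -/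
/-- **Gödel's second incompleteness theorem, algebraic form.** Let `H` be a Heyting
algebra and `□ : H → H` an operator satisfying the derivability conditions (A1), (A2),
(A3), and suppose the diagonalization `L = (□L ⇨ ⊥)` exists.  If `H` is nondegenerate
(`⊥ ≠ ⊤`), then `□⊥ ≠ ⊥`: the consistency statement is not provable. -/
theorem goedel_second {H : Type*} [HeytingAlgebra H] (box : H → H)
    (A1 : ∀ x : H, x = ⊤ → box x = ⊤)
    (A2 : ∀ x : H, box x ≤ box (box x))
    (A3 : ∀ x y : H, box (x ⇨ y) ≤ box x ⇨ box y)
    (L : H) (hL : L = (box L ⇨ ⊥))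
    (nondeg : (⊥ : H) ≠ ⊤) : box ⊥ ≠ ⊥ := by
  intro h
  have hbox : box L ≤ box (box L) ⇨ box ⊥ :=
    (congrArg box hL).le.trans (A3 (box L) ⊥)
  have hbot : box L = ⊥ := by
    rw [← le_bot_iff, ← h]
    exact (le_inf hbox (A2 L)).trans himp_inf_le
  have htop : L = ⊤ := by rw [hL, hbot, himp_self]
  exact nondeg (hbot.symm.trans (A1 L htop))
end

section
/- (Gödel's First Incompleteness Theorem, algebraic form.) Let H be a Heyting algebra and □ : H → H an operator satisfying: (A1) if x = ⊤ then □x = ⊤ (necessitation), and (R) if □x = ⊤ then x = ⊤ (reflection). Suppose there exists a Gödel sentence G ∈ H with G = (□G ⇨ ⊥). If H is complete, i.e. every x ∈ H satisfies x = ⊤ or x = ⊥, then H is degenerate: ⊤ = ⊥. -/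
/-- **Gödel's first incompleteness theorem, algebraic form.** Let `H` be a Heyting
algebra and `□ : H → H` an operator satisfying (A1) necessitation and (R) reflection,
and suppose a Gödel sentence `G = (□G ⇨ ⊥)` exists.  If `H` is complete (every element
is `⊤` or `⊥`), then `H` is degenerate: `⊤ = ⊥`. -/
theorem goedel_first {H : Type*} [HeytingAlgebra H] (box : H → H)
    (A1 : ∀ x : H, x = ⊤ → box x = ⊤)
    (R : ∀ x : H, box x = ⊤ → x = ⊤)
    (G : H) (hG : G = (box G ⇨ ⊥))
    (complete : ∀ x : H, x = ⊤ ∨ x = ⊥) : (⊤ : H) = ⊥ := by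
  have hG_top : G = ⊤ := by
    rcases complete (box G) with h | h
    · exact R G h
    · rw [hG, h, himp_self]
  rwa [A1 G hG_top, top_himp, hG_top] at hG
end
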